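/- Let p be an odd prime and define f : Z_p → ℝ by f(0) = 1, f(x) = 1 + √p if x ≠ 0 is a quadratic residue mod p, and f(x) = 1 − √p if x ≠ 0 is a quadratic non-residue mod p. Then the Fourier transform of f satisfies |f̂(m)| = 1 for every m ∈ Z_p; in particular f̂(0) = 1 and f̂(m) = p^{−1/2} Σ_{t ∈ Z_p} χ(−m t²) for m ≠ 0. -/

import Mathlib

open Finset

/-- The fixed character `χ(t) = e^{2πi t/p}` of `ℤ/p`. -/
noncomputable def chi (p : ℕ) (t : ZMod p) : ℂ :=
  Complex.exp (2 * Real.pi * Complex.I * (t.val : ℂ) / (p : ℂ))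

/-- The dot product on `ℤ_p^d`. -/
def dotp {p d : ℕ} (x y : Fin d → ZMod p) : ZMod p := ∑ i, x i * y i

/-- The Gabor (time-frequency shifted) function `x ↦ g(x-a) χ(x·b)`. -/
noncomputable def gabor {p d : ℕ} (g : (Fin d → ZMod p) → ℂ) (a b : Fin d → ZMod p) :
    (Fin d → ZMod p) → ℂ :=
  fun x => g (x - a) * chi p (dotp x b)

/-- The inner product of `L²` with counting measure on a finite type. -/
noncomputable def innerC {V : Type*} [Fintype V] (f g : V → ℂ) : ℂ :=
  ∑ x, f x * (starRingEnd ℂ) (g x)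

/-- `𝒢(g, A, B)` is an orthonormal basis of `L²(ℤ_p^d)`: the family is orthonormal and
every function is a linear combination of its members. -/
def IsGaborONB {p d : ℕ} [NeZero p] (g : (Fin d → ZMod p) → ℂ)
    (A B : Finset (Fin d → ZMod p)) : Prop :=
  (∀ a ∈ A, ∀ b ∈ B, ∀ a' ∈ A, ∀ b' ∈ B,
    innerC (gabor g a b) (gabor g a' b') = if a = a' ∧ b = b' then 1 else 0)
  ∧ (∀ f : (Fin d → ZMod p) → ℂ, ∃ c : (Fin d → ZMod p) → (Fin d → ZMod p) → ℂ,
      f = fun x => ∑ a ∈ A, ∑ b ∈ B, c a b * gabor g a b x)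

/-- `(E, B)` is a spectral pair: the characters indexed by `B` are pairwise orthogonal in
`L²(E)` and span it. -/
def IsSpectralPair {p d : ℕ} [NeZero p] (E B : Finset (Fin d → ZMod p)) : Prop :=
  (∀ b ∈ B, ∀ b' ∈ B, b ≠ b' → ∑ x ∈ E, chi p (dotp x (b - b')) = 0)
  ∧ (∀ f : (Fin d → ZMod p) → ℂ, ∃ c : (Fin d → ZMod p) → ℂ,
      ∀ x ∈ E, f x = ∑ b ∈ B, c b * chi p (dotp x b))

/-- `(E, A)` is a tiling pair: `Σ_{a∈A} 1_E(x-a) = 1` for every `x`. -/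
def IsTilingPair {p d : ℕ} [NeZero p] (E A : Finset (Fin d → ZMod p)) : Prop :=
  ∀ x : Fin d → ZMod p, (∑ a ∈ A, if x - a ∈ E then (1 : ℕ) else 0) = 1

/-- The Fourier transform `ĝ(m) = p^{-d} Σ_x χ(-x·m) g(x)` on `ℤ_p^d`. -/
noncomputable def ft {p d : ℕ} [NeZero p] (g : (Fin d → ZMod p) → ℂ)
    (m : Fin d → ZMod p) : ℂ :=
  ((p : ℂ) ^ d)⁻¹ * ∑ x, chi p (-(dotp x m)) * g x

/-- The Fourier transform on `ℤ_p` (one-dimensional case). -/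
noncomputable def ft1 {p : ℕ} [NeZero p] (f : ZMod p → ℂ) (m : ZMod p) : ℂ :=
  (p : ℂ)⁻¹ * ∑ x, chi p (-(x * m)) * f x

namespace QuadraticResidueWindow

/-- The complex-valued quadratic character of `ZMod p`. -/
noncomputable def quadChar (p : ℕ) [Fact p.Prime] : MulChar (ZMod p) ℂ :=
  (quadraticChar (ZMod p)).ringHomComp (Int.castRingHom ℂ)

variable {p : ℕ} [Fact p.Prime]

theorem quadChar_apply (x : ZMod p) : quadChar p x = (quadraticChar (ZMod p) x : ℂ) := rfl

theorem ringChar_ne_two (hp : Odd p) : ringChar (ZMod p) ≠ 2 := by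
  rw [ZMod.ringChar_zmod_n]
  rintro rfl
  exact absurd hp (by decide)

theorem chi_eq_stdAddChar (t : ZMod p) : chi p t = ZMod.stdAddChar t := by
  rw [ZMod.stdAddChar_apply, ZMod.toCircle_apply]
  rfl

theorem quadChar_isQuadratic : (quadChar p).IsQuadratic :=
  (quadraticChar_isQuadratic (ZMod p)).comp _

theorem quadChar_ne_one (hp : Odd p) : quadChar p ≠ 1 :=
  (MulChar.ringHomComp_ne_one_iff (RingHom.injective_int (Int.castRingHom ℂ))).mpr
    (quadraticChar_ne_one (ringChar_ne_two hp))

theorem isPrimitive_mulShift_stdAddChar {a : ZMod p} (ha : a ≠ 0) :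
    ((ZMod.stdAddChar (N := p)).mulShift a).IsPrimitive :=
  AddChar.IsPrimitive.of_ne_one (ZMod.isPrimitive_stdAddChar p ha)

theorem norm_gaussSum_quadChar (hp : Odd p) {ψ : AddChar (ZMod p) ℂ} (hψ : ψ.IsPrimitive) :
    ‖gaussSum (quadChar p) ψ‖ = √p := by
  have hunit : ‖quadChar p (-1)‖ = 1 := by
    rw [quadChar_apply]
    rcases quadraticChar_dichotomy (neg_ne_zero.mpr (one_ne_zero (α := ZMod p))) with h | h <;>
      simp [h]
  have hsq : ‖gaussSum (quadChar p) ψ ^ 2‖ = ‖quadChar p (-1) * Fintype.card (ZMod p)‖ :=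
    congrArg norm (gaussSum_sq (quadChar_ne_one hp) quadChar_isQuadratic hψ)
  rw [norm_mul, hunit, norm_pow, ZMod.card, Complex.norm_natCast, one_mul] at hsq
  rw [← hsq, Real.sqrt_sq (norm_nonneg _)]

/-- Summing a function over squares counts each `x` with multiplicity `1 + η(x)`. -/
theorem sum_comp_sq (hp : Odd p) (g : ZMod p → ℂ) :
    ∑ t, g (t ^ 2) = ∑ x, (1 + quadChar p x) * g x := by
  rw [← Finset.sum_fiberwise_of_maps_to (fun t _ => Finset.mem_univ (t ^ 2 : ZMod p))]
  refine Finset.sum_congr rfl fun x _ => ?_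
  have hcard := quadraticChar_card_sqrts (ringChar_ne_two hp) x
  have hset : {t : ZMod p | t ^ 2 = x}.toFinset = ({t | t ^ 2 = x} : Finset (ZMod p)) := by
    ext; simp
  rw [hset] at hcard
  rw [Finset.sum_congr rfl (g := fun _ => g x) (by simp +contextual), Finset.sum_const,
    nsmul_eq_mul, quadChar_apply, add_comm (1 : ℂ)]
  congr 1
  exact_mod_cast hcard

theorem sum_addChar_sq (hp : Odd p) {ψ : AddChar (ZMod p) ℂ} (hψ : ψ ≠ 1) :
    ∑ t, ψ (t ^ 2) = gaussSum (quadChar p) ψ := by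
  simp [sum_comp_sq hp, add_mul, Finset.sum_add_distrib, AddChar.sum_eq_zero_of_ne_one hψ,
    gaussSum]

theorem window_eq {f : ZMod p → ℂ}
    (hf : ∀ x : ZMod p, f x =
      if x = 0 then 1
      else if ∃ t : ZMod p, t ^ 2 = x then ((1 + Real.sqrt p : ℝ) : ℂ)
      else ((1 - Real.sqrt p : ℝ) : ℂ)) (x : ZMod p) :
    f x = 1 + (√p : ℝ) * quadChar p x := by
  have hsq : IsSquare x ↔ ∃ t : ZMod p, t ^ 2 = x := by
    simp only [isSquare_iff_exists_sq, eq_comm]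
  rw [hf, quadChar_apply]
  split_ifs with h0 h
  · simp [h0]
  · rw [(quadraticChar_one_iff_isSquare h0).mpr (hsq.mpr h)]
    simp
  · rw [quadraticChar_neg_one_iff_not_isSquare.mpr (hsq.not.mpr h)]
    simp [sub_eq_add_neg]

theorem ft1_window {f : ZMod p → ℂ} (hf : ∀ x, f x = 1 + (√p : ℝ) * quadChar p x)
    (m : ZMod p) :
    ft1 f m = (p : ℂ)⁻¹ * (∑ x, (ZMod.stdAddChar (N := p)).mulShift (-m) x +
      (√p : ℝ) * gaussSum (quadChar p) ((ZMod.stdAddChar (N := p)).mulShift (-m))) := by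
  rw [ft1, gaussSum, Finset.mul_sum (a := ((√p : ℝ) : ℂ)), ← Finset.sum_add_distrib]
  congr 1
  refine Finset.sum_congr rfl fun x _ => ?_
  rw [chi_eq_stdAddChar, hf, AddChar.mulShift_apply, neg_mul, mul_comm m x]
  ring

theorem ft1_window_zero (hp : Odd p) {f : ZMod p → ℂ}
    (hf : ∀ x, f x = 1 + (√p : ℝ) * quadChar p x) : ft1 f 0 = 1 := by
  have hp0 : (p : ℂ) ≠ 0 := Nat.cast_ne_zero.mpr (NeZero.ne p)
  rw [ft1_window hf, neg_zero, AddChar.mulShift_zero, gaussSum_one_right (quadChar_ne_one hp)]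
  simp [ZMod.card, hp0]

theorem ft1_window_of_ne_zero {f : ZMod p → ℂ}
    (hf : ∀ x, f x = 1 + (√p : ℝ) * quadChar p x) {m : ZMod p} (hm : m ≠ 0) :
    ft1 f m = ((√p : ℝ) : ℂ)⁻¹ *
      gaussSum (quadChar p) ((ZMod.stdAddChar (N := p)).mulShift (-m)) := by
  have hs : ((√p : ℝ) : ℂ) * (√p : ℝ) = p := by
    rw [← Complex.ofReal_mul, Real.mul_self_sqrt p.cast_nonneg, Complex.ofReal_natCast]
  have hp0 : (p : ℂ) ≠ 0 := Nat.cast_ne_zero.mpr (NeZero.ne p)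
  have hs0 : ((√p : ℝ) : ℂ) ≠ 0 := left_ne_zero_of_mul (hs ▸ hp0)
  rw [ft1_window hf, AddChar.sum_eq_zero_of_ne_one
    (ZMod.isPrimitive_stdAddChar p (neg_ne_zero.mpr hm)), zero_add, ← mul_assoc, ← hs]
  field_simp

end QuadraticResidueWindow

open QuadraticResidueWindow

/-- For an odd prime `p`, the function with `f(0)=1`, `f(x)=1+√p` on
nonzero quadratic residues and `f(x)=1-√p` on non-residues has `|f̂(m)| = 1` for all `m`;
moreover `f̂(0)=1` and `f̂(m) = p^{-1/2} Σ_t χ(-m t²)` for `m ≠ 0`. -/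
theorem fourier_of_quadratic_residue_window
    (p : ℕ) [Fact p.Prime] (hp : Odd p)
    (f : ZMod p → ℂ)
    (hf : ∀ x : ZMod p, f x =
      if x = 0 then 1
      else if ∃ t : ZMod p, t ^ 2 = x then ((1 + Real.sqrt p : ℝ) : ℂ)
      else ((1 - Real.sqrt p : ℝ) : ℂ)) :
    (∀ m, ‖ft1 f m‖ = 1) ∧ ft1 f 0 = 1 ∧
      ∀ m : ZMod p, m ≠ 0 →
        ft1 f m = ((Real.sqrt p : ℝ) : ℂ)⁻¹ * ∑ t : ZMod p, chi p (-(m * t ^ 2)) := by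
  have hw := window_eq hf
  have hzero := ft1_window_zero hp hw
  refine ⟨fun m => ?_, hzero, fun m hm => ?_⟩
  · rcases eq_or_ne m 0 with rfl | hm
    · rw [hzero, norm_one]
    · have hs0 : √(p : ℝ) ≠ 0 :=
        Real.sqrt_ne_zero'.mpr (Nat.cast_pos.mpr (NeZero.pos p))
      rw [ft1_window_of_ne_zero hw hm, norm_mul, norm_inv, Complex.norm_real,
        Real.norm_of_nonneg (Real.sqrt_nonneg _),
        norm_gaussSum_quadChar hp (isPrimitive_mulShift_stdAddChar (neg_ne_zero.mpr hm)),
        inv_mul_cancel₀ hs0]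
  · rw [ft1_window_of_ne_zero hw hm,
      ← sum_addChar_sq hp (ZMod.isPrimitive_stdAddChar p (neg_ne_zero.mpr hm))]
    simp only [AddChar.mulShift_apply, chi_eq_stdAddChar, neg_mul]
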